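/- Let n ≥ 1 and γ ≥ 0. Then there exists a constant C > 0 such that for every u₀ ∈ L^{1,γ}(ℝⁿ) and every t > 0, ( ∫_{|ξ|≤1} | E₀(t,ξ) û₀(ξ) − Σ_{k=0}^{⌊γ⌋} e₀^k(t,ξ) ( Σ_{j=0}^{⌊γ⌋−k} m[u₀]^j(ξ) ) |² dξ )^{1/2} ≤ C ‖u₀‖_{1,γ} (1+t)^{−n/4−γ/2}. -/

import Mathlib

open MeasureTheory Filter

noncomputable section

/-- Euclidean space `ℝⁿ`. -/
abbrev Rn (n : ℕ) := EuclideanSpace ℝ (Fin n)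

/-- Fourier transform `f̂(ξ) = ∫ e^{-i x·ξ} f(x) dx` of a real-valued `f`. -/
def fourierHat (n : ℕ) (f : Rn n → ℝ) (ξ : Rn n) : ℂ :=
  ∫ x : Rn n, Complex.exp (-Complex.I * ((∑ i, x i * ξ i : ℝ) : ℂ)) * (f x : ℂ)

/-- Membership in the weighted space `L^{1,γ}(ℝⁿ)`. -/
def MemL1w (n : ℕ) (γ : ℝ) (f : Rn n → ℝ) : Prop :=
  MeasureTheory.Integrable f ∧
    MeasureTheory.Integrable (fun x : Rn n => (1 + ‖x‖) ^ γ * |f x|)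

/-- The weighted norm `‖f‖_{1,γ}`. -/
def wnorm (n : ℕ) (γ : ℝ) (f : Rn n → ℝ) : ℝ :=
  ∫ x : Rn n, (1 + ‖x‖) ^ γ * |f x|

/-- The evolution operator multiplier `E₀(t,ξ)`. -/
def E0 (n : ℕ) (t : ℝ) (ξ : Rn n) : ℝ :=
  if ‖ξ‖ ≤ 2 then
    Real.exp (-(t * ‖ξ‖ ^ 2) / 2) * Real.cos (t * ‖ξ‖ * Real.sqrt (4 - ‖ξ‖ ^ 2) / 2)
  else
    Real.exp (-(t * ‖ξ‖ ^ 2) / 2) * Real.cosh (t * ‖ξ‖ * Real.sqrt (‖ξ‖ ^ 2 - 4) / 2)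

/-- The evolution operator multiplier `E₁(t,ξ)`. -/
def E1 (n : ℕ) (t : ℝ) (ξ : Rn n) : ℝ :=
  if ‖ξ‖ ≤ 2 then
    Real.exp (-(t * ‖ξ‖ ^ 2) / 2) *
      (Real.sin (t * ‖ξ‖ * Real.sqrt (4 - ‖ξ‖ ^ 2) / 2) /
        (‖ξ‖ * Real.sqrt (4 - ‖ξ‖ ^ 2) / 2))
  else
    Real.exp (-(t * ‖ξ‖ ^ 2) / 2) *
      (Real.sinh (t * ‖ξ‖ * Real.sqrt (‖ξ‖ ^ 2 - 4) / 2) /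
        (‖ξ‖ * Real.sqrt (‖ξ‖ ^ 2 - 4) / 2))

/-- `L₀(a,t,ξ)` as a function of `a`. -/
def L0fun (n : ℕ) (t : ℝ) (ξ : Rn n) (a : ℝ) : ℝ :=
  Real.cos (t * ‖ξ‖ - t * ‖ξ‖ ^ 2 * (a / (4 + 2 * Real.sqrt (4 - a ^ 2))))

/-- `L₁(a,t,ξ)` as a function of `a`. -/
def L1fun (n : ℕ) (t : ℝ) (ξ : Rn n) (a : ℝ) : ℝ :=
  Real.sin (t * ‖ξ‖ - t * ‖ξ‖ ^ 2 * (a / (4 + 2 * Real.sqrt (4 - a ^ 2)))) /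
    (‖ξ‖ * Real.sqrt (4 - a ^ 2) / 2)

/-- `e₀^k(t,ξ) = e^{-t|ξ|²/2} (1/k!) (∂^k L₀/∂a^k)(0,t,ξ) |ξ|^k`. -/
def e0 (n : ℕ) (k : ℕ) (t : ℝ) (ξ : Rn n) : ℝ :=
  Real.exp (-(t * ‖ξ‖ ^ 2) / 2) * ((1 : ℝ) / k.factorial) *
    iteratedDeriv k (L0fun n t ξ) 0 * ‖ξ‖ ^ k

/-- `e₁^k(t,ξ) = e^{-t|ξ|²/2} (1/k!) (∂^k L₁/∂a^k)(0,t,ξ) |ξ|^k`. -/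
def e1 (n : ℕ) (k : ℕ) (t : ℝ) (ξ : Rn n) : ℝ :=
  Real.exp (-(t * ‖ξ‖ ^ 2) / 2) * ((1 : ℝ) / k.factorial) *
    iteratedDeriv k (L1fun n t ξ) 0 * ‖ξ‖ ^ k

/-- The moment polynomial
`m[f]^k(ξ) = ∑_{|α|=k} ((-1)^{|α|}/α!) (∫ x^α f(x) dx) (iξ)^α`. -/
def mom (n : ℕ) (f : Rn n → ℝ) (k : ℕ) (ξ : Rn n) : ℂ :=
  ∑ α ∈ Finset.univ.filter (fun α : Fin n → Fin (k + 1) => ∑ i, (α i).val = k),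
    ((-1 : ℂ) ^ k / ∏ i, ((α i).val.factorial : ℂ)) *
      ((∫ x : Rn n, (∏ i, x i ^ (α i).val) * f x : ℝ) : ℂ) *
      ∏ i, (Complex.I * (ξ i : ℂ)) ^ (α i).val

/-- The Fourier-space solution of the strongly damped wave equation. -/
def uhat (n : ℕ) (u₀ u₁ : Rn n → ℝ) (t : ℝ) (ξ : Rn n) : ℂ :=
  (E0 n t ξ : ℂ) * fourierHat n u₀ ξ +
    (E1 n t ξ : ℂ) * (((‖ξ‖ ^ 2 / 2 : ℝ) : ℂ) * fourierHat n u₀ ξ + fourierHat n u₁ ξ)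

/-- The phase perturbation `a / (4 + 2 √(4 - a²))`. -/
def phase (a : ℝ) : ℝ := a / (4 + 2 * Real.sqrt (4 - a ^ 2))

lemma contDiffAt_phase {a : ℝ} (ha : a ∈ Set.Icc (0 : ℝ) 1) (m : ℕ) :
    ContDiffAt ℝ m phase a := by
  have h : (4 : ℝ) - a ^ 2 ≠ 0 := by nlinarith [ha.1, ha.2]
  refine contDiffAt_id.div (contDiffAt_const.add (contDiffAt_const.mul
    ((contDiffAt_const.sub (contDiffAt_id.pow 2)).sqrt h))) ?_
  have := Real.sqrt_nonneg (4 - a ^ 2)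
  positivity

lemma iteratedDerivWithin_cos_phase_bound (m : ℕ) :
    ∃ K : ℝ, 0 < K ∧ ∀ A B : ℝ, 0 ≤ B → ∀ k ≤ m, ∀ a ∈ Set.Icc (0 : ℝ) 1,
      ‖iteratedDerivWithin k (fun a => Real.cos (A - B * phase a)) (Set.Icc 0 1) a‖ ≤
        K * (1 + B) ^ m := by
  have hU : UniqueDiffOn ℝ (Set.Icc (0 : ℝ) 1) := uniqueDiffOn_Icc zero_lt_one
  have hP : ContDiffOn ℝ m phase (Set.Icc 0 1) := fun a ha =>
    (contDiffAt_phase ha m).contDiffWithinAt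
  have hb : ∀ i : ℕ, ∃ K : ℝ, i ≤ m → ∀ a ∈ Set.Icc (0 : ℝ) 1,
      ‖iteratedDerivWithin i phase (Set.Icc 0 1) a‖ ≤ K := by
    intro i
    by_cases hi : i ≤ m
    · obtain ⟨K, hK⟩ := isCompact_Icc.exists_bound_of_continuousOn
        (hP.continuousOn_iteratedDerivWithin (by exact_mod_cast hi) hU)
      exact ⟨K, fun _ => hK⟩
    · exact ⟨0, fun h => absurd h hi⟩
  choose K hK using hb
  set M : ℝ := 1 + ∑ i ∈ Finset.range (m + 1), |K i| with hM
  have hM1 : 1 ≤ M := by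
    have : 0 ≤ ∑ i ∈ Finset.range (m + 1), |K i| := Finset.sum_nonneg fun _ _ => abs_nonneg _
    linarith
  have hKM : ∀ i ≤ m, K i ≤ M := by
    intro i hi
    have := Finset.single_le_sum (f := fun i => |K i|) (fun _ _ => abs_nonneg _)
      (Finset.mem_range.2 (Nat.lt_succ_of_le hi))
    have h2 := le_abs_self (K i)
    linarith
  refine ⟨m.factorial * M ^ m, by positivity, fun A B hB k hk a ha => ?_⟩
  have hPk := hP.of_le (show ((k : ℕ) : WithTop ℕ∞) ≤ m by exact_mod_cast hk)
  have hD : 1 ≤ M * (1 + B) := by nlinarith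
  have h := norm_iteratedFDerivWithin_comp_le (𝕜 := ℝ) (g := Real.cos)
    (f := fun a => A - B * phase a) (n := k) (s := Set.Icc 0 1) (t := Set.univ) (x := a)
    (N := k) Real.contDiff_cos.contDiffOn (contDiffOn_const.sub (contDiffOn_const.mul hPk)) le_rfl
    uniqueDiffOn_univ hU (Set.mapsTo_univ _ _) ha (C := 1) (D := M * (1 + B)) ?_ ?_
  · rw [norm_iteratedFDerivWithin_eq_norm_iteratedDerivWithin] at h
    refine h.trans ?_
    rw [mul_one, mul_assoc, ← mul_pow]
    gcongr
  · intro i _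
    rw [norm_iteratedFDerivWithin_eq_norm_iteratedDerivWithin, iteratedDerivWithin_univ]
    exact Real.abs_iteratedDeriv_cos_le_one i _
  · intro i hi hik
    rw [norm_iteratedFDerivWithin_eq_norm_iteratedDerivWithin,
      iteratedDerivWithin_const_sub hi]
    have hPi : ContDiffWithinAt ℝ i phase (Set.Icc 0 1) a :=
      (contDiffAt_phase ha i).contDiffWithinAt
    have e : (fun z => -(B * phase z)) = fun z => (-B) * phase z := by ext; ring
    rw [e, iteratedDerivWithin_const_mul ha hU _ hPi, norm_mul, norm_neg, Real.norm_of_nonneg hB]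
    calc B * ‖iteratedDerivWithin i phase (Set.Icc 0 1) a‖ ≤ (1 + B) * M := by
          gcongr
          · linarith
          · exact (hK i (hik.trans hk) a ha).trans (hKM i (hik.trans hk))
      _ = M * (1 + B) := mul_comm _ _
      _ ≤ (M * (1 + B)) ^ i := le_self_pow₀ hD (by lia)

lemma L0fun_eq (n : ℕ) (t : ℝ) (ξ : Rn n) :
    L0fun n t ξ = fun a => Real.cos (t * ‖ξ‖ - t * ‖ξ‖ ^ 2 * phase a) := rfl

lemma iteratedDerivWithin_L0fun_zero (n k : ℕ) (t : ℝ) (ξ : Rn n) :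
    iteratedDerivWithin k (L0fun n t ξ) (Set.Icc 0 1) 0 = iteratedDeriv k (L0fun n t ξ) 0 := by
  have h0 : (0 : ℝ) ∈ Set.Icc (0 : ℝ) 1 := by simp
  refine iteratedDerivWithin_eq_iteratedDeriv (uniqueDiffOn_Icc zero_lt_one) ?_ h0
  rw [L0fun_eq]
  exact (contDiffAt_const.sub (contDiffAt_const.mul (contDiffAt_phase h0 k))).cos

lemma E0_eq {n : ℕ} (t : ℝ) {ξ : Rn n} (hξ : ‖ξ‖ ≤ 1) :
    E0 n t ξ = Real.exp (-(t * ‖ξ‖ ^ 2) / 2) * L0fun n t ξ ‖ξ‖ := by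
  rw [E0, if_pos (by linarith), L0fun]
  congr 2
  have hr := norm_nonneg ξ
  have hs := Real.sq_sqrt (show (0 : ℝ) ≤ 4 - ‖ξ‖ ^ 2 by nlinarith)
  have h0 := Real.sqrt_nonneg (4 - ‖ξ‖ ^ 2)
  set s := Real.sqrt (4 - ‖ξ‖ ^ 2)
  have : 4 + 2 * s ≠ 0 := by positivity
  field_simp
  linear_combination 2 * t * ‖ξ‖ * hs

lemma E0_expansion_bound (n N : ℕ) :
    ∃ K : ℝ, 0 < K ∧ ∀ t : ℝ, 0 < t → ∀ ξ : Rn n, ‖ξ‖ ≤ 1 →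
      |E0 n t ξ - ∑ k ∈ Finset.range (N + 1), e0 n k t ξ| ≤
        K * ((1 + t * ‖ξ‖ ^ 2) ^ (N + 1) * Real.exp (-(t * ‖ξ‖ ^ 2) / 2)) * ‖ξ‖ ^ (N + 1) ∧
      ∀ k ≤ N, |e0 n k t ξ| ≤
        K * ((1 + t * ‖ξ‖ ^ 2) ^ (N + 1) * Real.exp (-(t * ‖ξ‖ ^ 2) / 2)) * ‖ξ‖ ^ k := by
  obtain ⟨K, hK, hb⟩ := iteratedDerivWithin_cos_phase_bound (N + 1)
  refine ⟨K, hK, fun t ht ξ hξ => ?_⟩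
  have hb := hb (t * ‖ξ‖) (t * ‖ξ‖ ^ 2) (by positivity)
  rw [← L0fun_eq] at hb
  have hr := norm_nonneg ξ
  constructor
  · have hT := taylor_mean_remainder_bound (f := L0fun n t ξ) (a := 0) (b := 1) (n := N)
      (x := ‖ξ‖) zero_le_one (by
        intro a ha
        rw [L0fun_eq]
        exact (contDiffAt_const.sub (contDiffAt_const.mul
          (contDiffAt_phase ha (N + 1)))).cos.contDiffWithinAt) ⟨hr, hξ⟩ (hb (N + 1) le_rfl)
    rw [taylor_within_apply] at hT
    have e : E0 n t ξ - ∑ k ∈ Finset.range (N + 1), e0 n k t ξ =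
        Real.exp (-(t * ‖ξ‖ ^ 2) / 2) * (L0fun n t ξ ‖ξ‖ -
          ∑ k ∈ Finset.range (N + 1), (((k.factorial : ℝ))⁻¹ * (‖ξ‖ - 0) ^ k) •
            iteratedDerivWithin k (L0fun n t ξ) (Set.Icc 0 1) 0) := by
      rw [E0_eq t hξ, mul_sub, Finset.mul_sum]
      congr 1
      refine Finset.sum_congr rfl fun k _ => ?_
      rw [iteratedDerivWithin_L0fun_zero, e0, smul_eq_mul]
      ring
    rw [e, abs_mul, abs_of_pos (Real.exp_pos _)]
    calc _ ≤ Real.exp (-(t * ‖ξ‖ ^ 2) / 2) * (K * (1 + t * ‖ξ‖ ^ 2) ^ (N + 1) *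
          (‖ξ‖ - 0) ^ (N + 1) / N.factorial) := by gcongr; exact hT
      _ ≤ Real.exp (-(t * ‖ξ‖ ^ 2) / 2) * (K * (1 + t * ‖ξ‖ ^ 2) ^ (N + 1) *
          (‖ξ‖ - 0) ^ (N + 1)) := by
        gcongr
        rw [sub_zero]
        exact div_le_self (by positivity) (by exact_mod_cast N.factorial_pos)
      _ = _ := by rw [sub_zero]; ring
  · intro k hk
    have h := hb k (by lia) 0 (by simp)
    rw [iteratedDerivWithin_L0fun_zero, Real.norm_eq_abs] at h
    have hf : (1 : ℝ) / k.factorial ≤ 1 :=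
      (div_le_one (by positivity)).2 (by exact_mod_cast k.factorial_pos)
    rw [e0, abs_mul, abs_mul, abs_mul, abs_of_pos (Real.exp_pos _),
      abs_of_nonneg (show (0 : ℝ) ≤ 1 / k.factorial by positivity), abs_of_nonneg (pow_nonneg hr k)]
    calc _ ≤ Real.exp (-(t * ‖ξ‖ ^ 2) / 2) * 1 * (K * (1 + t * ‖ξ‖ ^ 2) ^ (N + 1)) * ‖ξ‖ ^ k := by
          gcongr
      _ = _ := by ring

lemma norm_exp_sub_sum_le (z : ℂ) (hz : z.re = 0) (M : ℕ) {θ : ℝ} (h1 : (M : ℝ) ≤ θ)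
    (h2 : θ ≤ M + 1) :
    ‖Complex.exp z - ∑ j ∈ Finset.range (M + 1), z ^ j / (j.factorial : ℂ)‖ ≤
      (M + 2) * ‖z‖ ^ θ := by
  have hz0 := norm_nonneg z
  rcases le_total ‖z‖ 1 with hz1 | hz1
  · have h := Complex.exp_bound hz1 (Nat.succ_pos M)
    have hc : ((M + 1).succ : ℝ) * ((M + 1).factorial * ((M + 1 : ℕ) : ℝ))⁻¹ ≤ M + 2 := by
      have : (1 : ℝ) ≤ (M + 1).factorial * ((M + 1 : ℕ) : ℝ) := by
        exact_mod_cast Nat.mul_pos (Nat.factorial_pos _) (Nat.succ_pos M)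
      have h3 := inv_le_one_of_one_le₀ this
      calc _ ≤ ((M + 1).succ : ℝ) * 1 := by gcongr
        _ = _ := by push_cast; ring
    have hp : ‖z‖ ^ (M + 1) ≤ ‖z‖ ^ θ := by
      have hθ : 0 ≤ θ := le_trans (Nat.cast_nonneg M) h1
      rw [← Real.rpow_natCast]
      exact Real.rpow_le_rpow_of_exponent_ge_of_imp hz0 hz1 (by push_cast; exact h2)
        (fun _ h => by
          push_cast at *
          linarith)
    calc _ ≤ ‖z‖ ^ (M + 1) * (((M + 1).succ : ℝ) * ((M + 1).factorial * ((M + 1 : ℕ) : ℝ))⁻¹) := h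
      _ ≤ ‖z‖ ^ θ * (M + 2) := by gcongr
      _ = _ := mul_comm _ _
  · have hp : ∀ j ≤ M, ‖z‖ ^ j ≤ ‖z‖ ^ θ := fun j hj => by
      rw [← Real.rpow_natCast]
      exact Real.rpow_le_rpow_of_exponent_le hz1 (le_trans (by exact_mod_cast hj) h1)
    have he : ‖Complex.exp z‖ ≤ ‖z‖ ^ θ := by
      rw [Complex.norm_exp, hz, Real.exp_zero]
      simpa using hp 0 (Nat.zero_le M)
    have hs : ‖∑ j ∈ Finset.range (M + 1), z ^ j / (j.factorial : ℂ)‖ ≤ (M + 1) * ‖z‖ ^ θ := by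
      calc _ ≤ ∑ j ∈ Finset.range (M + 1), ‖z‖ ^ θ := by
            refine norm_sum_le_of_le _ fun j hj => ?_
            rw [norm_div, norm_pow, Complex.norm_natCast]
            exact (div_le_self (by positivity) (by exact_mod_cast j.factorial_pos)).trans
              (hp j (Nat.lt_succ_iff.1 (Finset.mem_range.1 hj)))
        _ = _ := by simp
    calc _ ≤ _ := norm_sub_le _ _
      _ ≤ ‖z‖ ^ θ + (M + 1) * ‖z‖ ^ θ := add_le_add he hs
      _ = _ := by ring

lemma abs_apply_le_norm {n : ℕ} (x : Rn n) (i : Fin n) : |x i| ≤ ‖x‖ := by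
  simpa using PiLp.norm_apply_le x i

lemma abs_sum_mul_le_norm_mul {n : ℕ} (x ξ : Rn n) : |∑ i, x i * ξ i| ≤ ‖x‖ * ‖ξ‖ := by
  have := norm_inner_le_norm (𝕜 := ℝ) ξ x
  rw [PiLp.inner_apply, Real.norm_eq_abs] at this
  simpa [mul_comm] using this

lemma integrable_monomial {n : ℕ} {γ : ℝ} {u : Rn n → ℝ} (hu : MemL1w n γ u) {k : ℕ}
    (hk : (k : ℝ) ≤ γ) (α : Fin n → ℕ) (hα : ∑ i, α i = k) :
    Integrable (fun x : Rn n => (∏ i, x i ^ α i) * u x) := by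
  refine hu.2.mono' (AEStronglyMeasurable.mul ?_ hu.1.aestronglyMeasurable) (.of_forall fun x => ?_)
  · exact Continuous.aestronglyMeasurable (by fun_prop)
  · rw [norm_mul, Real.norm_eq_abs (u x)]
    gcongr
    have h1 : (1 : ℝ) ≤ 1 + ‖x‖ := by linarith [norm_nonneg x]
    calc ‖∏ i, x i ^ α i‖ ≤ ∏ i, (1 + ‖x‖) ^ α i := by
          rw [norm_prod]
          refine Finset.prod_le_prod (fun _ _ => norm_nonneg _) fun i _ => ?_
          rw [norm_pow]
          gcongr
          exact (abs_apply_le_norm x i).trans (by linarith)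
      _ = (1 + ‖x‖) ^ (k : ℝ) := by rw [Finset.prod_pow_eq_pow_sum, hα, Real.rpow_natCast]
      _ ≤ _ := Real.rpow_le_rpow_of_exponent_le h1 hk

lemma neg_I_mul_pow_div_factorial {n : ℕ} (x ξ : Rn n) (k : ℕ) :
    (-Complex.I * ((∑ i, x i * ξ i : ℝ) : ℂ)) ^ k / (k.factorial : ℂ) =
      ∑ α ∈ Finset.univ.filter (fun α : Fin n → Fin (k + 1) => ∑ i, (α i).val = k),
        ((-1 : ℂ) ^ k / ∏ i, ((α i).val.factorial : ℂ)) * ((∏ i, x i ^ (α i).val : ℝ) : ℂ) *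
          ∏ i, (Complex.I * (ξ i : ℂ)) ^ (α i).val := by
  have e : -Complex.I * ((∑ i, x i * ξ i : ℝ) : ℂ) =
      (-1) * ∑ i, (x i : ℂ) * (Complex.I * (ξ i : ℂ)) := by
    push_cast
    rw [Finset.mul_sum, Finset.mul_sum]
    exact Finset.sum_congr rfl fun i _ => by ring
  rw [e, mul_pow, Finset.sum_pow_eq_sum_piAntidiag, Finset.mul_sum, Finset.sum_div]
  symm
  refine Finset.sum_bij' (fun α _ i => (α i).val)
    (fun β hβ i => ⟨β i, Nat.lt_succ_of_le ?_⟩) ?_ ?_ ?_ ?_ ?_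
  · rw [← (Finset.mem_piAntidiag.1 hβ).1]
    exact Finset.single_le_sum (f := β) (fun _ _ => Nat.zero_le _) (Finset.mem_univ i)
  · intro α hα
    simpa [Finset.mem_piAntidiag] using hα
  · intro β hβ
    simpa [Finset.mem_piAntidiag] using hβ
  · intro α _
    rfl
  · intro β _
    rfl
  · intro α hα
    have hs : ∑ i, (α i).val = k := (Finset.mem_filter.1 hα).2
    have hm := Nat.multinomial_spec Finset.univ (fun i => (α i).val)
    rw [hs] at hm
    have hk : (k.factorial : ℂ) ≠ 0 := by exact_mod_cast k.factorial_ne_zero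
    have hp : (∏ i, ((α i).val.factorial : ℂ)) ≠ 0 :=
      Finset.prod_ne_zero_iff.2 fun i _ => by exact_mod_cast Nat.factorial_ne_zero _
    have hm' : (∏ i, ((α i).val.factorial : ℂ)) *
        (Nat.multinomial Finset.univ (fun i => (α i).val) : ℂ) = k.factorial := by
      exact_mod_cast hm
    simp only [mul_pow, Finset.prod_mul_distrib]
    push_cast
    rw [← hm'] at hk ⊢
    have hq := right_ne_zero_of_mul hk
    field_simp

lemma integrable_and_mom_eq {n : ℕ} {γ : ℝ} {u : Rn n → ℝ} (hu : MemL1w n γ u) {k : ℕ}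
    (hk : (k : ℝ) ≤ γ) (ξ : Rn n) :
    Integrable (fun x : Rn n =>
      (-Complex.I * ((∑ i, x i * ξ i : ℝ) : ℂ)) ^ k / (k.factorial : ℂ) * (u x : ℂ)) ∧
    mom n u k ξ = ∫ x : Rn n,
      (-Complex.I * ((∑ i, x i * ξ i : ℝ) : ℂ)) ^ k / (k.factorial : ℂ) * (u x : ℂ) := by
  have e : (fun x : Rn n =>
      (-Complex.I * ((∑ i, x i * ξ i : ℝ) : ℂ)) ^ k / (k.factorial : ℂ) * (u x : ℂ)) = fun x =>
      ∑ α ∈ Finset.univ.filter (fun α : Fin n → Fin (k + 1) => ∑ i, (α i).val = k),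
        ((-1 : ℂ) ^ k / ∏ i, ((α i).val.factorial : ℂ)) *
          (((∏ i, x i ^ (α i).val) * u x : ℝ) : ℂ) *
          ∏ i, (Complex.I * (ξ i : ℂ)) ^ (α i).val := by
    ext x
    rw [neg_I_mul_pow_div_factorial, Finset.sum_mul]
    refine Finset.sum_congr rfl fun α _ => ?_
    rw [Complex.ofReal_mul]
    ring
  have hi : ∀ α ∈ Finset.univ.filter (fun α : Fin n → Fin (k + 1) => ∑ i, (α i).val = k),
      Integrable (fun x : Rn n => ((-1 : ℂ) ^ k / ∏ i, ((α i).val.factorial : ℂ)) *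
          (((∏ i, x i ^ (α i).val) * u x : ℝ) : ℂ) *
          ∏ i, (Complex.I * (ξ i : ℂ)) ^ (α i).val) := fun α hα =>
    ((integrable_monomial hu hk _ (Finset.mem_filter.1 hα).2).ofReal.const_mul _).mul_const _
  rw [e]
  refine ⟨integrable_finsetSum _ hi, ?_⟩
  rw [integral_finsetSum _ hi, mom]
  refine Finset.sum_congr rfl fun α _ => ?_
  rw [integral_mul_const, integral_const_mul, integral_complex_ofReal]

lemma neg_I_mul_re (s : ℝ) : (-Complex.I * (s : ℂ)).re = 0 := by simp

lemma norm_exp_neg_I_mul (s : ℝ) : ‖Complex.exp (-Complex.I * (s : ℂ))‖ = 1 := by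
  rw [Complex.norm_exp, neg_I_mul_re, Real.exp_zero]

lemma norm_fourierHat_le {n : ℕ} {γ : ℝ} (hγ : 0 ≤ γ) {u : Rn n → ℝ} (hu : MemL1w n γ u)
    (ξ : Rn n) : ‖fourierHat n u ξ‖ ≤ wnorm n γ u := by
  refine norm_integral_le_of_norm_le hu.2 (.of_forall fun x => ?_)
  rw [norm_mul, norm_exp_neg_I_mul, Complex.norm_real, Real.norm_eq_abs]
  gcongr
  exact Real.one_le_rpow (by linarith [norm_nonneg x]) hγ

lemma norm_fourierHat_sub_mom_le {n : ℕ} {γ : ℝ} {u : Rn n → ℝ} (hu : MemL1w n γ u)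
    (M : ℕ) {θ : ℝ} (h1 : (M : ℝ) ≤ θ) (h2 : θ ≤ M + 1) (hθ : θ ≤ γ) (ξ : Rn n) :
    ‖fourierHat n u ξ - ∑ j ∈ Finset.range (M + 1), mom n u j ξ‖ ≤
      (M + 2) * ‖ξ‖ ^ θ * wnorm n γ u := by
  have hm : ∀ j ∈ Finset.range (M + 1), (j : ℝ) ≤ γ := fun j hj => by
    have : (j : ℝ) ≤ M := by exact_mod_cast Nat.lt_succ_iff.1 (Finset.mem_range.1 hj)
    linarith
  have hF : Integrable (fun x : Rn n =>
      Complex.exp (-Complex.I * ((∑ i, x i * ξ i : ℝ) : ℂ)) * (u x : ℂ)) := by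
    refine hu.1.ofReal.bdd_mul (c := 1) ?_ (.of_forall fun x => (norm_exp_neg_I_mul _).le)
    exact Continuous.aestronglyMeasurable (by fun_prop)
  rw [Finset.sum_congr rfl fun j hj => (integrable_and_mom_eq hu (hm j hj) ξ).2,
    ← integral_finsetSum _ fun j hj => (integrable_and_mom_eq hu (hm j hj) ξ).1, fourierHat,
    ← integral_sub hF (integrable_finsetSum _ fun j hj =>
      (integrable_and_mom_eq hu (hm j hj) ξ).1), wnorm, ← integral_const_mul]
  refine norm_integral_le_of_norm_le (hu.2.const_mul _) (.of_forall fun x => ?_)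
  rw [← Finset.sum_mul, ← sub_mul, norm_mul, Complex.norm_real, Real.norm_eq_abs]
  have hθ0 : 0 ≤ θ := le_trans (Nat.cast_nonneg M) h1
  have hx : (1 : ℝ) ≤ 1 + ‖x‖ := by linarith [norm_nonneg x]
  calc _ ≤ (M + 2) * ‖-Complex.I * ((∑ i, x i * ξ i : ℝ) : ℂ)‖ ^ θ * |u x| := by
        gcongr
        exact norm_exp_sub_sum_le _ (neg_I_mul_re _) M h1 h2
    _ ≤ (M + 2) * ((1 + ‖x‖) ^ γ * ‖ξ‖ ^ θ) * |u x| := by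
        gcongr
        rw [norm_mul, norm_neg, Complex.norm_I, one_mul, Complex.norm_real, Real.norm_eq_abs]
        calc |∑ i, x i * ξ i| ^ θ ≤ ((1 + ‖x‖) * ‖ξ‖) ^ θ := by
              gcongr
              exact (abs_sum_mul_le_norm_mul x ξ).trans (by gcongr; linarith)
          _ = (1 + ‖x‖) ^ θ * ‖ξ‖ ^ θ := Real.mul_rpow (by linarith) (norm_nonneg _)
          _ ≤ _ := by
              gcongr
    _ = _ := by ring

lemma one_add_pow_le_exp_half (p : ℕ) {y : ℝ} (hy : 0 ≤ y) :
    (1 + y) ^ p ≤ 2 ^ p * p.factorial * Real.exp (1 / 2) * Real.exp (y / 2) := by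
  have h := Real.pow_div_factorial_le_exp ((1 + y) / 2) (by linarith) p
  rw [div_le_iff₀ (by positivity), div_pow, div_le_iff₀ (by positivity)] at h
  rw [mul_assoc, ← Real.exp_add]
  calc _ ≤ _ := h
    _ = _ := by rw [show (1 + y) / 2 = 1 / 2 + y / 2 by ring]; ring

lemma weight_sq_le_gaussian {γ : ℝ} (hγ : 0 ≤ γ) (m : ℕ) :
    ∃ K : ℝ, 0 < K ∧ ∀ t : ℝ, 0 < t → ∀ r : ℝ, 0 ≤ r → r ≤ 1 →
      ((1 + t * r ^ 2) ^ m * Real.exp (-(t * r ^ 2) / 2) * r ^ γ) ^ 2 ≤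
        K * (1 + t) ^ (-γ) * Real.exp (-((1 + t) / 2) * r ^ 2) := by
  set p : ℕ := m * 2 + ⌈γ⌉₊ with hp
  refine ⟨2 ^ p * p.factorial * Real.exp (1 / 2) * Real.exp 1, by positivity,
    fun t ht r hr hr1 => ?_⟩
  set y : ℝ := (1 + t) * r ^ 2 with hy
  have hy0 : 0 ≤ y := by positivity
  have ht1 : 0 < 1 + t := by linarith
  have hrγ : (r ^ γ) ^ 2 = (1 + t) ^ (-γ) * y ^ γ := by
    rw [hy, Real.mul_rpow ht1.le (by positivity), ← mul_assoc, ← Real.rpow_add ht1,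
      neg_add_cancel, Real.rpow_zero, one_mul, ← Real.rpow_natCast, ← Real.rpow_natCast,
      ← Real.rpow_mul hr, ← Real.rpow_mul hr, mul_comm]
  have hyγ : y ^ γ ≤ (1 + y) ^ ⌈γ⌉₊ := by
    rw [← Real.rpow_natCast]
    calc y ^ γ ≤ (1 + y) ^ γ := by gcongr; linarith
      _ ≤ _ := Real.rpow_le_rpow_of_exponent_le (by linarith) (Nat.le_ceil γ)
  have hexp : Real.exp (-(t * r ^ 2) / 2) ^ 2 ≤ Real.exp 1 * Real.exp (-y) := by
    rw [← Real.exp_nat_mul, ← Real.exp_add, Real.exp_le_exp, hy]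
    push_cast
    nlinarith
  have hpow : (1 + t * r ^ 2) ^ m ≤ (1 + y) ^ m := by
    have : t * r ^ 2 ≤ y := by rw [hy]; nlinarith [sq_nonneg r]
    gcongr
  calc _ = ((1 + t * r ^ 2) ^ m) ^ 2 * Real.exp (-(t * r ^ 2) / 2) ^ 2 * (r ^ γ) ^ 2 := by ring
    _ ≤ ((1 + y) ^ m) ^ 2 * (Real.exp 1 * Real.exp (-y)) *
        ((1 + t) ^ (-γ) * (1 + y) ^ ⌈γ⌉₊) := by
      rw [hrγ]
      gcongr
    _ = (1 + y) ^ p * (Real.exp 1 * Real.exp (-y) * (1 + t) ^ (-γ)) := by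
      rw [hp, pow_add, pow_mul]
      ring
    _ ≤ 2 ^ p * p.factorial * Real.exp (1 / 2) * Real.exp (y / 2) *
        (Real.exp 1 * Real.exp (-y) * (1 + t) ^ (-γ)) := by
      gcongr
      exact one_add_pow_le_exp_half p hy0
    _ = 2 ^ p * p.factorial * Real.exp (1 / 2) * Real.exp 1 * (1 + t) ^ (-γ) *
        (Real.exp (y / 2) * Real.exp (-y)) := by ring
    _ = _ := by
      rw [← Real.exp_add]
      congr 2
      rw [hy]
      ring

lemma norm_expansion_error_le (n : ℕ) {γ : ℝ} (hγ : 0 ≤ γ) :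
    ∃ K : ℝ, 0 < K ∧ ∀ u₀ : Rn n → ℝ, MemL1w n γ u₀ → ∀ t : ℝ, 0 < t → ∀ ξ : Rn n, ‖ξ‖ ≤ 1 →
      ‖(E0 n t ξ : ℂ) * fourierHat n u₀ ξ -
            ∑ k ∈ Finset.range (⌊γ⌋₊ + 1), (e0 n k t ξ : ℂ) *
              ∑ j ∈ Finset.range (⌊γ⌋₊ - k + 1), mom n u₀ j ξ‖ ≤
        K * wnorm n γ u₀ *
          ((1 + t * ‖ξ‖ ^ 2) ^ (⌊γ⌋₊ + 1) * Real.exp (-(t * ‖ξ‖ ^ 2) / 2) * ‖ξ‖ ^ γ) := by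
  set N := ⌊γ⌋₊ with hN
  obtain ⟨K, hK, hE⟩ := E0_expansion_bound n N
  refine ⟨K * (1 + (N + 1) * (N + 2)), by positivity, fun u₀ hu t ht ξ hξ => ?_⟩
  obtain ⟨hE1, hE2⟩ := hE t ht ξ hξ
  set G := (1 + t * ‖ξ‖ ^ 2) ^ (N + 1) * Real.exp (-(t * ‖ξ‖ ^ 2) / 2)
  have hG : 0 ≤ G := by positivity
  have hr := norm_nonneg ξ
  have hw : 0 ≤ wnorm n γ u₀ := integral_nonneg fun x => by positivity
  have hNγ : (N : ℝ) ≤ γ := Nat.floor_le hγ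
  have hγN : γ ≤ N + 1 := (Nat.lt_floor_add_one γ).le
  have e : (E0 n t ξ : ℂ) * fourierHat n u₀ ξ - ∑ k ∈ Finset.range (N + 1), (e0 n k t ξ : ℂ) *
        ∑ j ∈ Finset.range (N - k + 1), mom n u₀ j ξ =
      ((E0 n t ξ - ∑ k ∈ Finset.range (N + 1), e0 n k t ξ : ℝ) : ℂ) * fourierHat n u₀ ξ +
      ∑ k ∈ Finset.range (N + 1), (e0 n k t ξ : ℂ) *
        (fourierHat n u₀ ξ - ∑ j ∈ Finset.range (N - k + 1), mom n u₀ j ξ) := by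
    simp only [mul_sub, Finset.sum_sub_distrib, ← Finset.sum_mul]
    push_cast
    ring
  have hpow : ‖ξ‖ ^ (N + 1) ≤ ‖ξ‖ ^ γ := by
    rw [← Real.rpow_natCast]
    refine Real.rpow_le_rpow_of_exponent_ge_of_imp hr hξ (by push_cast; exact hγN) fun _ h => ?_
    push_cast at h
    linarith
  have h1 : ‖((E0 n t ξ - ∑ k ∈ Finset.range (N + 1), e0 n k t ξ : ℝ) : ℂ) * fourierHat n u₀ ξ‖ ≤
      K * G * ‖ξ‖ ^ γ * wnorm n γ u₀ := by
    rw [norm_mul, Complex.norm_real, Real.norm_eq_abs]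
    have := norm_fourierHat_le hγ hu ξ
    gcongr
    exact hE1.trans (by gcongr)
  have h2 : ∀ k ∈ Finset.range (N + 1), ‖(e0 n k t ξ : ℂ) *
        (fourierHat n u₀ ξ - ∑ j ∈ Finset.range (N - k + 1), mom n u₀ j ξ)‖ ≤
      K * G * ‖ξ‖ ^ γ * ((N + 2) * wnorm n γ u₀) := by
    intro k hk
    have hkN : k ≤ N := Nat.lt_succ_iff.1 (Finset.mem_range.1 hk)
    have hkN' : (k : ℝ) ≤ N := by exact_mod_cast hkN
    have hk0 : (0 : ℝ) ≤ k := Nat.cast_nonneg k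
    have hc : ((N - k : ℕ) : ℝ) = N - k := Nat.cast_sub hkN
    have hF := norm_fourierHat_sub_mom_le hu (N - k) (θ := γ - k) (by rw [hc]; linarith)
      (by rw [hc]; linarith) (by linarith) ξ
    rw [norm_mul, Complex.norm_real, Real.norm_eq_abs]
    have hs : ‖ξ‖ ^ γ = ‖ξ‖ ^ k * ‖ξ‖ ^ (γ - k) := by
      rw [← Real.rpow_natCast, ← Real.rpow_add_of_nonneg hr hk0 (by linarith)]
      congr 1
      ring
    calc _ ≤ (K * G * ‖ξ‖ ^ k) * ((((N - k : ℕ) : ℝ) + 2) * ‖ξ‖ ^ (γ - k) * wnorm n γ u₀) := by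
          gcongr
          exact hE2 k hkN
      _ ≤ (K * G * ‖ξ‖ ^ k) * ((N + 2) * ‖ξ‖ ^ (γ - k) * wnorm n γ u₀) := by
          gcongr
          exact Nat.sub_le N k
      _ = _ := by rw [hs]; ring
  rw [e]
  calc _ ≤ _ := norm_add_le _ _
    _ ≤ K * G * ‖ξ‖ ^ γ * wnorm n γ u₀ +
        ∑ k ∈ Finset.range (N + 1), K * G * ‖ξ‖ ^ γ * ((N + 2) * wnorm n γ u₀) :=
      add_le_add h1 (norm_sum_le_of_le _ h2)
    _ = _ := by
      rw [Finset.sum_const, Finset.card_range, nsmul_eq_mul]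
      push_cast
      ring

theorem stmt2 (n : ℕ) (hn : 1 ≤ n) (γ : ℝ) (hγ : 0 ≤ γ) :
    ∃ C : ℝ, 0 < C ∧ ∀ u₀ : Rn n → ℝ, MemL1w n γ u₀ → ∀ t : ℝ, 0 < t →
      Real.sqrt (∫ ξ in Metric.closedBall (0 : Rn n) 1,
          ‖(E0 n t ξ : ℂ) * fourierHat n u₀ ξ -
            ∑ k ∈ Finset.range (⌊γ⌋₊ + 1), (e0 n k t ξ : ℂ) *
              ∑ j ∈ Finset.range (⌊γ⌋₊ - k + 1), mom n u₀ j ξ‖ ^ 2) ≤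
        C * wnorm n γ u₀ * (1 + t) ^ (-(n : ℝ) / 4 - γ / 2) := by
  obtain ⟨K, hK, hpt⟩ := norm_expansion_error_le n hγ
  obtain ⟨K', hK', hG⟩ := weight_sq_le_gaussian hγ (⌊γ⌋₊ + 1)
  refine ⟨K * Real.sqrt (K' * (2 * Real.pi) ^ ((n : ℝ) / 2)), by positivity,
    fun u₀ hu t ht => ?_⟩
  have hw : 0 ≤ wnorm n γ u₀ := integral_nonneg fun x => by positivity
  have ht1 : 0 < 1 + t := by linarith
  have hint : ∫ ξ : Rn n, Real.exp (-((1 + t) / 2) * ‖ξ‖ ^ 2) =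
      (2 * Real.pi) ^ ((n : ℝ) / 2) * (1 + t) ^ (-((n : ℝ) / 2)) := by
    rw [GaussianFourier.integral_rexp_neg_mul_sq_norm (by positivity), finrank_euclideanSpace_fin,
      Real.rpow_neg ht1.le, ← div_eq_mul_inv, ← Real.div_rpow (by positivity) ht1.le]
    congr 1
    field_simp
  have hgauss : Integrable fun ξ : Rn n => Real.exp (-((1 + t) / 2) * ‖ξ‖ ^ 2) := by
    refine not_imp_comm.1 integral_undef ?_
    rw [hint]
    positivity
  have hbound : ∫ ξ in Metric.closedBall (0 : Rn n) 1,
      ‖(E0 n t ξ : ℂ) * fourierHat n u₀ ξ -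
        ∑ k ∈ Finset.range (⌊γ⌋₊ + 1), (e0 n k t ξ : ℂ) *
          ∑ j ∈ Finset.range (⌊γ⌋₊ - k + 1), mom n u₀ j ξ‖ ^ 2 ≤
      (K * wnorm n γ u₀) ^ 2 * (K' * (1 + t) ^ (-γ)) *
        ((2 * Real.pi) ^ ((n : ℝ) / 2) * (1 + t) ^ (-((n : ℝ) / 2))) := by
    rw [← hint, ← integral_const_mul]
    refine le_trans (integral_mono_of_nonneg (.of_forall fun ξ => by positivity)
      (hgauss.const_mul _).integrableOn ?_) (setIntegral_le_integral (hgauss.const_mul _)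
        (.of_forall fun ξ => by positivity))
    filter_upwards [ae_restrict_mem measurableSet_closedBall] with ξ hξ
    have hξ : ‖ξ‖ ≤ 1 := by simpa using hξ
    calc _ ≤ _ := pow_le_pow_left₀ (norm_nonneg _) (hpt u₀ hu t ht ξ hξ) 2
      _ = (K * wnorm n γ u₀) ^ 2 * _ := mul_pow _ _ _
      _ ≤ (K * wnorm n γ u₀) ^ 2 * _ :=
        mul_le_mul_of_nonneg_left (hG t ht ‖ξ‖ (norm_nonneg _) hξ) (sq_nonneg _)
      _ = _ := by ring
  refine (Real.sqrt_le_sqrt hbound).trans (Real.sqrt_le_iff.2 ⟨by positivity, ?_⟩)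
  rw [mul_pow, mul_pow, mul_pow, mul_pow, Real.sq_sqrt (by positivity)]
  have hpow : ((1 + t) ^ (-(n : ℝ) / 4 - γ / 2)) ^ 2 =
      (1 + t) ^ (-γ) * (1 + t) ^ (-((n : ℝ) / 2)) := by
    rw [← Real.rpow_natCast, ← Real.rpow_mul ht1.le, ← Real.rpow_add ht1]
    congr 1
    push_cast
    ring
  rw [hpow]
  exact le_of_eq (by ring)
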